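/- arXiv:2407.03829 — 2 statements merged into one kernel-verified Lean document; each statement's English description precedes it below -/
import Mathlib

section
/- Let T > 0, θ ∈ (0,1], γ₀ ≥ 0 with 1 + γ₀ − θ > 0, ν ∈ [0,1), ℓ > 0, ω ≥ 1 and c_T > 0. Let E₀ be a real Banach space and let E_θ and E_γ be real Banach spaces continuously embedded in E₀, with E_θ dense in E₀. Let S : [0,T] → L(E₀) satisfy: (i) S(0)x = x and t ↦ S(t)x is continuous from [0,T] to E₀ for every x ∈ E₀; (ii) ‖S(t)x‖_{E₀} ≤ ω‖x‖_{E₀} for all t ∈ [0,T], x ∈ E₀; (iii) for t ∈ (0,T], S(t) maps E₀ into E_θ with ‖S(t)x‖_{E_θ} ≤ ω t^{−θ}‖x‖_{E₀}; (iv) ‖S(t)y‖_{E_θ} ≤ ω‖y‖_{E_θ} for all t ∈ [0,T] and y ∈ E_θ; (v) ‖S(t)z‖_{E_θ} ≤ ω t^{γ₀−θ}‖z‖_{E_γ} for all t ∈ (0,T] and z ∈ E_γ; (vi) t ↦ S(t)x is continuous from (0,T] to E_θ for every x ∈ E₀. Let f : C_θ((0,T],E_θ) → C_ν((0,T],E_γ)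 with f(0) = 0 and Σ : C_θ((0,T],E_θ) → E₀ be maps such that for every L ∈ (0,1) and all v, w ∈ C_θ((0,T],E_θ) with ‖v‖_{C_θ((0,T],E_θ)} + ‖w‖_{C_θ((0,T],E_θ)} ≤ L and sup_{t∈(0,T]}(‖v(t)‖_{E₀} + ‖w(t)‖_{E₀}) ≤ L one has ‖f(v) − f(w)‖_{C_ν((0,T],E_γ)} ≤ c_T L^ℓ ‖v − w‖_{C_θ((0,T],E_θ)} and ‖Σ(v) − Σ(w)‖_{E₀} ≤ c_T L^ℓ ‖v − w‖_{C_θ((0,T],E_θ)}. Then there exist L ∈ (0,1) and m > 0 such that, whenever ‖Σ(0)‖_{E₀} ≤ m, there exists exactly one function u : [0,T] → E₀ which is continuous from [0,T] to E₀, whose restriction to (0,T] belongs to C_θ((0,T],E_θ), which satisfies ‖u‖_{C_θ((0,T],E_θ)} + sup_{t∈[0,T]}‖u(t)‖_{E₀} ≤ L, and which solves the mild equation u(t) = S(t)Σ(u) + ∫₀ᵗ S(t−s) f(u)(s) ds in E₀ for all t ∈ [0,T] (the integral being a Bochner integral). -/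
open MeasureTheory Set Filter

/-- `u` belongs to the time-weighted space `C_θ((0,T],E)`: it is continuous on `(0,T]`
and `t^θ‖u(t)‖ → 0` as `t → 0⁺`. -/
def memC {E : Type*} [NormedAddCommGroup E] (θ T : ℝ) (u : ℝ → E) : Prop :=
  ContinuousOn u (Set.Ioc 0 T) ∧
    Filter.Tendsto (fun t => t ^ θ * ‖u t‖) (nhdsWithin 0 (Set.Ioi 0)) (nhds 0)

/-- The norm of the time-weighted space `C_θ((0,T],E)`:
`‖u‖ = sup_{t ∈ (0,T]} t^θ‖u(t)‖`. -/
noncomputable def wnorm {E : Type*} [NormedAddCommGroup E] (θ T : ℝ) (u : ℝ → E) : ℝ :=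
  sSup ((fun t => t ^ θ * ‖u t‖) '' Set.Ioc 0 T)

open Topology Interval

section WeightedSpace

variable {E : Type*} [NormedAddCommGroup E] {θ T : ℝ} {u v : ℝ → E}

theorem memC.congr (hT : 0 < T) (hu : memC θ T u) (h : EqOn v u (Ioc 0 T)) : memC θ T v := by
  refine ⟨hu.1.congr h, hu.2.congr' ?_⟩
  filter_upwards [Ioc_mem_nhdsGT hT] with t ht
  rw [h ht]

theorem memC_zero : memC θ T (0 : ℝ → E) :=
  ⟨continuousOn_const, by simp⟩

theorem memC.add (hu : memC θ T u) (hv : memC θ T v) : memC θ T (fun t => u t + v t) := by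
  refine ⟨hu.1.add hv.1, ?_⟩
  have h := hu.2.add hv.2
  rw [add_zero] at h
  refine squeeze_zero' ?_ ?_ h
  · filter_upwards [self_mem_nhdsWithin] with t ht
    have : 0 < t := ht
    positivity
  · filter_upwards [self_mem_nhdsWithin] with t ht
    have : 0 < t := ht
    rw [← mul_add]
    gcongr
    exact norm_add_le _ _

theorem memC.neg (hu : memC θ T u) : memC θ T (fun t => -u t) :=
  ⟨hu.1.neg, by simpa using hu.2⟩

theorem memC.sub (hu : memC θ T u) (hv : memC θ T v) : memC θ T (fun t => u t - v t) := by
  simpa only [sub_eq_add_neg] using hu.add hv.neg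

theorem continuousOn_rpow_mul_norm (hu : ContinuousOn u (Ioc 0 T)) :
    ContinuousOn (fun t => t ^ θ * ‖u t‖) (Ioc 0 T) :=
  (continuousOn_id.rpow_const fun _ ht => Or.inl ht.1.ne').mul hu.norm

theorem memC.bddAbove (hu : memC θ T u) :
    BddAbove ((fun t => t ^ θ * ‖u t‖) '' Ioc 0 T) := by
  obtain ⟨δ, hδ, hδ'⟩ := (mem_nhdsGT_iff_exists_Ioc_subset).1
    (hu.2.eventually (gt_mem_nhds (zero_lt_one' ℝ)))
  obtain ⟨C, hC⟩ := isCompact_Icc.bddAbove_image ((continuousOn_rpow_mul_norm (θ := θ) hu.1).mono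
    (fun t ht => ⟨lt_of_lt_of_le hδ ht.1, ht.2⟩ : Icc δ T ⊆ Ioc 0 T))
  refine ⟨max 1 C, ?_⟩
  rintro _ ⟨t, ht, rfl⟩
  rcases le_total t δ with h | h
  · exact le_max_of_le_left (hδ' ⟨ht.1, h⟩).le
  · exact le_max_of_le_right (hC ⟨t, ⟨h, ht.2⟩, rfl⟩)

theorem memC.le_wnorm (hu : memC θ T u) {t : ℝ} (ht : t ∈ Ioc 0 T) :
    t ^ θ * ‖u t‖ ≤ wnorm θ T u :=
  le_csSup hu.bddAbove ⟨t, ht, rfl⟩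

theorem memC.norm_le (hu : memC θ T u) {t : ℝ} (ht : t ∈ Ioc 0 T) :
    ‖u t‖ ≤ t ^ (-θ) * wnorm θ T u := by
  have h := hu.le_wnorm ht
  rwa [Real.rpow_neg ht.1.le, inv_mul_eq_div, le_div_iff₀' (Real.rpow_pos_of_pos ht.1 _)]

theorem wnorm_le {M : ℝ} (hT : 0 < T) (h : ∀ t ∈ Ioc 0 T, t ^ θ * ‖u t‖ ≤ M) :
    wnorm θ T u ≤ M := by
  refine csSup_le ((nonempty_Ioc.2 hT).image _) ?_
  rintro _ ⟨t, ht, rfl⟩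
  exact h t ht

theorem wnorm_nonneg : 0 ≤ wnorm θ T u := by
  refine Real.sSup_nonneg ?_
  rintro _ ⟨t, ht, rfl⟩
  have := ht.1
  positivity

theorem wnorm_congr (h : EqOn u v (Ioc 0 T)) : wnorm θ T u = wnorm θ T v := by
  unfold wnorm
  congr 1
  exact image_congr fun t ht => by rw [h ht]

theorem memC.eqOn_of_wnorm_sub_le_zero (hu : memC θ T u) (hv : memC θ T v)
    (h : wnorm θ T (fun t => u t - v t) ≤ 0) : EqOn u v (Ioc 0 T) := by
  intro t ht
  have h1 := ((hu.sub hv).norm_le ht).trans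
    (mul_nonpos_of_nonneg_of_nonpos (Real.rpow_nonneg ht.1.le _) h)
  exact sub_eq_zero.1 (norm_le_zero_iff.1 h1)

theorem memC.continuousOn_Icc (hu : memC 0 T u) (hu0 : u 0 = 0) : ContinuousOn u (Icc 0 T) := by
  intro t ht
  rcases ht.1.eq_or_lt with rfl | h0
  · refine (continuousWithinAt_Ioi_iff_Ici.1 ?_).mono Icc_subset_Ici_self
    rw [ContinuousWithinAt, hu0, tendsto_zero_iff_norm_tendsto_zero]
    simpa using hu.2
  · refine (hu.1 t ⟨h0, ht.2⟩).mono_of_mem_nhdsWithin ?_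
    filter_upwards [self_mem_nhdsWithin, mem_nhdsWithin_of_mem_nhds (Ioi_mem_nhds h0)] with s hs hs0
    exact ⟨hs0, hs.2⟩

theorem memC_of_forall_approx [NormedSpace ℝ E] (hT : 0 < T)
    (h : ∀ ε > 0, ∃ w, memC θ T w ∧ ∀ t ∈ Ioc 0 T, t ^ θ * ‖u t - w t‖ ≤ ε) : memC θ T u := by
  constructor
  · have hc : ContinuousOn (fun t => t ^ θ • u t) (Ioc 0 T) := by
      refine continuousOn_of_uniform_approx_of_continuousOn fun V hV => ?_
      obtain ⟨ε, hε, hεV⟩ := Metric.mem_uniformity_dist.1 hV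
      obtain ⟨w, hw, hw'⟩ := h (ε / 2) (half_pos hε)
      refine ⟨fun t => t ^ θ • w t,
        (continuousOn_id.rpow_const fun _ ht => Or.inl ht.1.ne').smul hw.1, fun t ht => hεV ?_⟩
      rw [dist_eq_norm, ← smul_sub, norm_smul, Real.norm_of_nonneg (Real.rpow_nonneg ht.1.le _)]
      exact (hw' t ht).trans_lt (half_lt_self hε)
    refine ((continuousOn_id.rpow_const (p := -θ) fun _ ht => Or.inl ht.1.ne').smul hc).congr ?_
    intro t ht
    simp [smul_smul, ← Real.rpow_add ht.1]
  · refine Metric.tendsto_nhds.2 fun ε hε => ?_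
    obtain ⟨w, hw, hw'⟩ := h (ε / 2) (half_pos hε)
    filter_upwards [Ioc_mem_nhdsGT hT, Metric.tendsto_nhds.1 hw.2 (ε / 2) (half_pos hε)]
      with t ht hwt
    have hpos := Real.rpow_nonneg ht.1.le θ
    rw [Real.dist_eq, sub_zero, abs_of_nonneg (by positivity)] at hwt ⊢
    have h1 : ‖u t‖ ≤ ‖u t - w t‖ + ‖w t‖ := by simpa using norm_add_le (u t - w t) (w t)
    have h2 := mul_le_mul_of_nonneg_left h1 hpos
    rw [mul_add] at h2
    linarith [hw' t ht]

/-- Banach's fixed point theorem on a pointwise closed subset of a weighted space. -/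
theorem exists_fixedPoint_of_wnorm_contraction [NormedSpace ℝ E] [CompleteSpace E] (hT : 0 < T)
    {X : Set (ℝ → E)} (hX : IsClosed X) (hX0 : ∀ u ∈ X, ∀ t ∉ Ioc 0 T, u t = 0)
    {Φ : (ℝ → E) → ℝ → E}
    (hΦX : ∀ u ∈ X, memC θ T u → Φ u ∈ X) (hΦC : ∀ u ∈ X, memC θ T u → memC θ T (Φ u))
    {K : ℝ} (hK0 : 0 ≤ K) (hK1 : K < 1)
    (hΦ : ∀ u ∈ X, ∀ v ∈ X, memC θ T u → memC θ T v →
      wnorm θ T (fun t => Φ u t - Φ v t) ≤ K * wnorm θ T (fun t => u t - v t))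
    {u₀ : ℝ → E} (hu₀ : u₀ ∈ X) (hu₀' : memC θ T u₀) :
    ∃ u ∈ X, memC θ T u ∧ Φ u = u := by
  set U : ℕ → ℝ → E := fun n => Φ^[n] u₀ with hU
  have hUs : ∀ n, U (n + 1) = Φ (U n) := fun n => Function.iterate_succ_apply' Φ n u₀
  have hUX : ∀ n, U n ∈ X ∧ memC θ T (U n) := by
    intro n
    induction n with
    | zero => exact ⟨hu₀, hu₀'⟩
    | succ n ih => rw [hUs]; exact ⟨hΦX _ ih.1 ih.2, hΦC _ ih.1 ih.2⟩
  set C := wnorm θ T (fun t => U 0 t - U 1 t) with hC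
  have hstep : ∀ n, wnorm θ T (fun t => U n t - U (n + 1) t) ≤ C * K ^ n := by
    intro n
    induction n with
    | zero => simp [hC]
    | succ n ih =>
      have h1 := hΦ _ (hUX n).1 _ (hUX (n + 1)).1 (hUX n).2 (hUX (n + 1)).2
      rw [← hUs, ← hUs] at h1
      calc _ ≤ _ := h1
        _ ≤ K * (C * K ^ n) := by gcongr
        _ = _ := by ring
  have hdist : ∀ t ∈ Ioc 0 T, ∀ n, dist (U n t) (U (n + 1) t) ≤ t ^ (-θ) * C * K ^ n := by
    intro t ht n
    rw [dist_eq_norm, mul_assoc]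
    exact (((hUX n).2.sub (hUX (n + 1)).2).norm_le ht).trans
      (mul_le_mul_of_nonneg_left (hstep n) (Real.rpow_nonneg ht.1.le _))
  have hlim : ∀ t, ∃ y, Tendsto (fun n => U n t) atTop (𝓝 y) := by
    intro t
    by_cases ht : t ∈ Ioc 0 T
    · exact cauchySeq_tendsto_of_complete (cauchySeq_of_le_geometric _ _ hK1 (hdist t ht))
    · exact ⟨0, by simp [hX0 _ (hUX _).1 t ht]⟩
  choose u hu using hlim
  have huX : u ∈ X :=
    hX.mem_of_tendsto (tendsto_pi_nhds.2 hu) (Eventually.of_forall fun n => (hUX n).1)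
  have happ : ∀ n, ∀ t ∈ Ioc 0 T, t ^ θ * ‖u t - U n t‖ ≤ C * K ^ n / (1 - K) := by
    intro n t ht
    have h1 := dist_le_of_le_geometric_of_tendsto _ _ hK1 (hdist t ht) (hu t) n
    rw [dist_comm, dist_eq_norm] at h1
    refine (mul_le_mul_of_nonneg_left h1 (Real.rpow_nonneg ht.1.le θ)).trans_eq ?_
    have h2 : t ^ θ * t ^ (-θ) = 1 := by rw [← Real.rpow_add ht.1]; simp
    linear_combination (C * K ^ n / (1 - K)) * h2
  have htend : Tendsto (fun n => C * K ^ n / (1 - K)) atTop (𝓝 0) := by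
    simpa using ((tendsto_pow_atTop_nhds_zero_of_lt_one hK0 hK1).const_mul C).div_const (1 - K)
  have huC : memC θ T u := by
    refine memC_of_forall_approx hT fun ε hε => ?_
    obtain ⟨n, hn⟩ := (htend.eventually (gt_mem_nhds hε)).exists
    exact ⟨U n, (hUX n).2, fun t ht => (happ n t ht).trans hn.le⟩
  have hΦu : Tendsto U atTop (𝓝 (Φ u)) := by
    refine tendsto_pi_nhds.2 fun t => ?_
    by_cases ht : t ∈ Ioc 0 T
    · rw [← tendsto_add_atTop_iff_nat 1, tendsto_iff_dist_tendsto_zero]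
      have h0 : Tendsto (fun n => t ^ (-θ) * (K * (C * K ^ n / (1 - K)))) atTop (𝓝 0) := by
        simpa using (htend.const_mul K).const_mul (t ^ (-θ))
      refine squeeze_zero (fun _ => dist_nonneg) (fun n => ?_) h0
      rw [dist_comm, dist_eq_norm, hUs]
      refine (((hΦC _ huX huC).sub (hΦC _ (hUX n).1 (hUX n).2)).norm_le ht).trans ?_
      refine mul_le_mul_of_nonneg_left ?_ (Real.rpow_nonneg ht.1.le _)
      exact (hΦ _ huX _ (hUX n).1 huC (hUX n).2).trans
        (mul_le_mul_of_nonneg_left (wnorm_le hT (happ n)) hK0)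
    · simp [hX0 _ (hUX _).1 t ht, hX0 _ (hΦX _ huX huC) t ht]
  exact ⟨u, huX, huC, tendsto_nhds_unique hΦu (tendsto_pi_nhds.2 hu)⟩

end WeightedSpace

section Convolution

theorem intervalIntegrable_one_sub_rpow_mul_rpow {a b : ℝ} (ha : -1 < a) (hb : -1 < b) :
    IntervalIntegrable (fun σ : ℝ => (1 - σ) ^ a * σ ^ b) volume 0 1 := by
  have h := (Complex.betaIntegral_convergent (u := b + 1) (v := a + 1)
    (by simp; linarith) (by simp; linarith)).norm
  rw [intervalIntegrable_iff_integrableOn_Ioo_of_le zero_le_one] at h ⊢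
  refine h.congr_fun (fun σ hσ => ?_) measurableSet_Ioo
  have h1 : (1 : ℂ) - σ = ((1 - σ : ℝ) : ℂ) := by push_cast; ring
  simp only [add_sub_cancel_right, norm_mul]
  rw [h1, Complex.norm_cpow_eq_rpow_re_of_pos hσ.1,
    Complex.norm_cpow_eq_rpow_re_of_pos (sub_pos.2 hσ.2), Complex.ofReal_re, Complex.ofReal_re,
    mul_comm]

theorem integral_convolution_eq_scaled {G F : Type*} [NormedAddCommGroup F] [NormedSpace ℝ F]
    (R : ℝ → G → F) (g : ℝ → G) (t : ℝ) :
    ∫ s in (0 : ℝ)..t, R (t - s) (g s) =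
      t • ∫ σ in (0 : ℝ)..1, R (t * (1 - σ)) (g (t * σ)) := by
  have := intervalIntegral.smul_integral_comp_mul_left (a := 0) (b := 1)
    (fun s => R (t - s) (g s)) t
  simpa only [mul_sub, mul_one, mul_zero] using this.symm

variable {G F : Type*} [NormedAddCommGroup G] [NormedAddCommGroup F]

/-- A strongly continuous family on `(0,T]` of maps vanishing at `0` whose Lipschitz constants
are controlled by `M * t ^ a`. -/
structure IsSingularFamily (a M T : ℝ) (R : ℝ → G → F) : Prop where
  lipschitz : ∀ t ∈ Ioc 0 T, ∀ z w, ‖R t z - R t w‖ ≤ M * t ^ a * ‖z - w‖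
  map_zero : ∀ t ∈ Ioc 0 T, R t 0 = 0
  continuousOn : ∀ z, ContinuousOn (fun t => R t z) (Ioc 0 T)

variable {a M T ν : ℝ} {R : ℝ → G → F} {g h : ℝ → G}

theorem IsSingularFamily.continuousOn_comp (hR : IsSingularFamily a M T R) {s : Set ℝ}
    {r : ℝ → ℝ} {q : ℝ → G} (hr : ContinuousOn r s) (hrs : MapsTo r s (Ioc 0 T))
    (hq : ContinuousOn q s) : ContinuousOn (fun x => R (r x) (q x)) s := by
  intro x hx
  have h1 : Tendsto (fun y => M * r y ^ a * ‖q y - q x‖ + ‖R (r y) (q x) - R (r x) (q x)‖)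
      (𝓝[s] x) (𝓝 0) := by
    have h2 : Tendsto (fun y => M * r y ^ a * ‖q y - q x‖) (𝓝[s] x) (𝓝 (M * r x ^ a * 0)) := by
      exact Tendsto.mul (((hr x hx).rpow_const (Or.inl (hrs hx).1.ne')).const_mul M)
        (tendsto_iff_norm_sub_tendsto_zero.1 (hq x hx))
    have h3 : Tendsto (fun y => ‖R (r y) (q x) - R (r x) (q x)‖) (𝓝[s] x) (𝓝 0) :=
      tendsto_iff_norm_sub_tendsto_zero.1 (((hR.continuousOn (q x)).comp hr hrs) x hx)
    simpa using h2.add h3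
  refine tendsto_iff_norm_sub_tendsto_zero.2 (squeeze_zero' (Eventually.of_forall fun _ =>
    norm_nonneg _) ?_ h1)
  filter_upwards [self_mem_nhdsWithin] with y hy
  refine (norm_sub_le_norm_sub_add_norm_sub _ (R (r y) (q x)) _).trans ?_
  gcongr
  exact hR.lipschitz _ (hrs hy) _ _

theorem mul_mem_Ioc {t σ : ℝ} (ht : t ∈ Ioc 0 T) (hσ : σ ∈ Ioo (0 : ℝ) 1) : t * σ ∈ Ioc 0 T :=
  ⟨mul_pos ht.1 hσ.1, by nlinarith [ht.1, ht.2, hσ.2]⟩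

theorem one_sub_mem_Ioo {σ : ℝ} (hσ : σ ∈ Ioo (0 : ℝ) 1) : 1 - σ ∈ Ioo (0 : ℝ) 1 :=
  ⟨by linarith [hσ.2], by linarith [hσ.1]⟩

theorem IsSingularFamily.norm_sub_le (hR : IsSingularFamily a M T R) (hM : 0 ≤ M)
    (hg : memC ν T g) (hh : memC ν T h) {t σ : ℝ} (ht : t ∈ Ioc 0 T) (hσ : σ ∈ Ioo (0 : ℝ) 1) :
    ‖R (t * (1 - σ)) (g (t * σ)) - R (t * (1 - σ)) (h (t * σ))‖ ≤
      M * wnorm ν T (fun s => g s - h s) * t ^ (a - ν) * ((1 - σ) ^ a * σ ^ (-ν)) := by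
  have h1 := hR.lipschitz _ (mul_mem_Ioc ht (one_sub_mem_Ioo hσ)) (g (t * σ)) (h (t * σ))
  have h2 := (hg.sub hh).norm_le (mul_mem_Ioc ht hσ)
  have hp : 0 ≤ M * (t * (1 - σ)) ^ a :=
    mul_nonneg hM (Real.rpow_nonneg (mul_mem_Ioc ht (one_sub_mem_Ioo hσ)).1.le _)
  refine (h1.trans (mul_le_mul_of_nonneg_left h2 hp)).trans_eq ?_
  rw [Real.mul_rpow ht.1.le (one_sub_mem_Ioo hσ).1.le, Real.mul_rpow ht.1.le hσ.1.le,
    sub_eq_add_neg a ν, Real.rpow_add ht.1]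
  ring

theorem IsSingularFamily.norm_le (hR : IsSingularFamily a M T R) (hM : 0 ≤ M)
    (hg : memC ν T g) {t σ : ℝ} (ht : t ∈ Ioc 0 T) (hσ : σ ∈ Ioo (0 : ℝ) 1) :
    ‖R (t * (1 - σ)) (g (t * σ))‖ ≤
      M * wnorm ν T g * t ^ (a - ν) * ((1 - σ) ^ a * σ ^ (-ν)) := by
  simpa [hR.map_zero _ (mul_mem_Ioc ht (one_sub_mem_Ioo hσ))] using
    hR.norm_sub_le hM hg memC_zero ht hσ

theorem ae_mem_uIoc_imp {p : ℝ → Prop} (hp : ∀ σ ∈ Ioo (0 : ℝ) 1, p σ) :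
    ∀ᵐ σ : ℝ, σ ∈ Ι (0 : ℝ) 1 → p σ := by
  filter_upwards [Measure.ae_ne volume (1 : ℝ)] with σ h1 hσ
  rw [uIoc_of_le zero_le_one] at hσ
  exact hp σ ⟨hσ.1, lt_of_le_of_ne hσ.2 h1⟩

theorem IsSingularFamily.aestronglyMeasurable (hR : IsSingularFamily a M T R)
    (hg : memC ν T g) {t : ℝ} (ht : t ∈ Ioc 0 T) :
    AEStronglyMeasurable (fun σ => R (t * (1 - σ)) (g (t * σ)))
      (volume.restrict (Ι (0 : ℝ) 1)) := by
  rw [uIoc_of_le zero_le_one, ← restrict_Ioo_eq_restrict_Ioc]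
  refine ContinuousOn.aestronglyMeasurable ?_ measurableSet_Ioo
  refine hR.continuousOn_comp (by fun_prop)
    (fun σ hσ => mul_mem_Ioc ht (one_sub_mem_Ioo hσ)) ?_
  exact hg.1.comp (by fun_prop) fun σ hσ => mul_mem_Ioc ht hσ

theorem IsSingularFamily.intervalIntegrable_scaled (hR : IsSingularFamily a M T R) (hM : 0 ≤ M)
    (ha : -1 < a) (hν : ν < 1) (hg : memC ν T g) {t : ℝ} (ht : t ∈ Ioc 0 T) :
    IntervalIntegrable (fun σ => R (t * (1 - σ)) (g (t * σ))) volume 0 1 := by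
  refine ((intervalIntegrable_one_sub_rpow_mul_rpow ha (b := -ν) (by linarith)).const_mul
    (M * wnorm ν T g * t ^ (a - ν))).mono_fun (hR.aestronglyMeasurable hg ht) ?_
  refine (ae_restrict_iff' measurableSet_uIoc).2 (ae_mem_uIoc_imp fun σ hσ => ?_)
  exact (hR.norm_le hM hg ht hσ).trans (le_abs_self _)

theorem IsSingularFamily.intervalIntegrable (hR : IsSingularFamily a M T R) (hM : 0 ≤ M)
    (ha : -1 < a) (hν : ν < 1) (hg : memC ν T g) {t : ℝ} (ht : t ∈ Icc 0 T) :
    IntervalIntegrable (fun s => R (t - s) (g s)) volume 0 t := by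
  rcases ht.1.eq_or_lt with rfl | h0
  · exact IntervalIntegrable.refl
  · have h1 := hR.intervalIntegrable_scaled hM ha hν hg ⟨h0, ht.2⟩
    rw [← IntervalIntegrable.comp_mul_left_iff h0.ne', zero_div, div_self h0.ne']
    simpa only [mul_sub, mul_one] using h1

variable [NormedSpace ℝ F]

theorem IsSingularFamily.norm_integral_sub_le (hR : IsSingularFamily a M T R) (hM : 0 ≤ M)
    (ha : -1 < a) (hν : ν < 1) (hg : memC ν T g) (hh : memC ν T h) {t : ℝ} (ht : t ∈ Ioc 0 T) :
    ‖(∫ s in (0 : ℝ)..t, R (t - s) (g s)) - ∫ s in (0 : ℝ)..t, R (t - s) (h s)‖ ≤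
      M * (∫ σ in (0 : ℝ)..1, (1 - σ) ^ a * σ ^ (-ν)) * t ^ (1 + a - ν) *
        wnorm ν T (fun s => g s - h s) := by
  rw [integral_convolution_eq_scaled, integral_convolution_eq_scaled, ← smul_sub,
    ← intervalIntegral.integral_sub (hR.intervalIntegrable_scaled hM ha hν hg ht)
      (hR.intervalIntegrable_scaled hM ha hν hh ht), norm_smul, Real.norm_of_nonneg ht.1.le]
  have h1 := intervalIntegral.norm_integral_le_of_norm_le zero_le_one
    (uIoc_of_le (zero_le_one' ℝ) ▸ ae_mem_uIoc_imp fun σ hσ => hR.norm_sub_le hM hg hh ht hσ)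
    ((intervalIntegrable_one_sub_rpow_mul_rpow ha (b := -ν) (by linarith)).const_mul _)
  rw [intervalIntegral.integral_const_mul] at h1
  refine (mul_le_mul_of_nonneg_left h1 ht.1.le).trans_eq ?_
  have h2 : t ^ (1 + a - ν) = t * t ^ (a - ν) := by
    rw [add_sub_assoc, Real.rpow_add ht.1, Real.rpow_one]
  rw [h2]
  ring

theorem IsSingularFamily.norm_integral_le (hR : IsSingularFamily a M T R) (hM : 0 ≤ M)
    (ha : -1 < a) (hν : ν < 1) (hg : memC ν T g) {t : ℝ} (ht : t ∈ Ioc 0 T) :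
    ‖∫ s in (0 : ℝ)..t, R (t - s) (g s)‖ ≤
      M * (∫ σ in (0 : ℝ)..1, (1 - σ) ^ a * σ ^ (-ν)) * t ^ (1 + a - ν) * wnorm ν T g := by
  have h0 : ∫ s in (0 : ℝ)..t, R (t - s) (0 : G) = 0 := by
    have := integral_convolution_eq_scaled R 0 t
    rw [Pi.zero_def] at this
    rw [this, intervalIntegral.integral_zero_ae, smul_zero]
    exact ae_mem_uIoc_imp fun σ hσ => hR.map_zero _ (mul_mem_Ioc ht (one_sub_mem_Ioo hσ))
  simpa only [Pi.zero_apply, h0, sub_zero] using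
    hR.norm_integral_sub_le hM ha hν hg memC_zero ht

theorem rpow_mul_mul_rpow_le {t T κ p C w : ℝ} (ht : t ∈ Ioc 0 T) (hκ : 0 ≤ κ + p)
    (hC : 0 ≤ C) (hw : 0 ≤ w) : t ^ κ * (C * t ^ p * w) ≤ C * T ^ (κ + p) * w := by
  have h1 : t ^ (κ + p) ≤ T ^ (κ + p) := Real.rpow_le_rpow ht.1.le ht.2 hκ
  calc t ^ κ * (C * t ^ p * w) = C * t ^ (κ + p) * w := by rw [Real.rpow_add ht.1]; ring
    _ ≤ _ := by gcongr

theorem integral_one_sub_rpow_mul_rpow_nonneg (a b : ℝ) :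
    0 ≤ ∫ σ in (0 : ℝ)..1, (1 - σ) ^ a * σ ^ b :=
  intervalIntegral.integral_nonneg zero_le_one fun σ hσ =>
    mul_nonneg (Real.rpow_nonneg (by linarith [hσ.2]) _) (Real.rpow_nonneg hσ.1 _)

theorem IsSingularFamily.rpow_mul_norm_integral_sub_le (hR : IsSingularFamily a M T R)
    (hM : 0 ≤ M) (ha : -1 < a) (hν : ν < 1) (hg : memC ν T g) (hh : memC ν T h) {κ t : ℝ}
    (hκ : 0 ≤ κ + (1 + a - ν)) (ht : t ∈ Ioc 0 T) :
    t ^ κ * ‖(∫ s in (0 : ℝ)..t, R (t - s) (g s)) - ∫ s in (0 : ℝ)..t, R (t - s) (h s)‖ ≤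
      M * (∫ σ in (0 : ℝ)..1, (1 - σ) ^ a * σ ^ (-ν)) * T ^ (κ + (1 + a - ν)) *
        wnorm ν T (fun s => g s - h s) :=
  (mul_le_mul_of_nonneg_left (hR.norm_integral_sub_le hM ha hν hg hh ht)
    (Real.rpow_nonneg ht.1.le κ)).trans (rpow_mul_mul_rpow_le ht hκ
      (mul_nonneg hM (integral_one_sub_rpow_mul_rpow_nonneg _ _)) wnorm_nonneg)

theorem IsSingularFamily.rpow_mul_norm_integral_le (hR : IsSingularFamily a M T R)
    (hM : 0 ≤ M) (ha : -1 < a) (hν : ν < 1) (hg : memC ν T g) {κ t : ℝ}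
    (hκ : 0 ≤ κ + (1 + a - ν)) (ht : t ∈ Ioc 0 T) :
    t ^ κ * ‖∫ s in (0 : ℝ)..t, R (t - s) (g s)‖ ≤
      M * (∫ σ in (0 : ℝ)..1, (1 - σ) ^ a * σ ^ (-ν)) * T ^ (κ + (1 + a - ν)) *
        wnorm ν T g :=
  (mul_le_mul_of_nonneg_left (hR.norm_integral_le hM ha hν hg ht)
    (Real.rpow_nonneg ht.1.le κ)).trans (rpow_mul_mul_rpow_le ht hκ
      (mul_nonneg hM (integral_one_sub_rpow_mul_rpow_nonneg _ _)) wnorm_nonneg)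

theorem IsSingularFamily.continuousOn_integral (hR : IsSingularFamily a M T R) (hM : 0 ≤ M)
    (ha : -1 < a) (hν : ν < 1) (hg : memC ν T g) :
    ContinuousOn (fun t => ∫ s in (0 : ℝ)..t, R (t - s) (g s)) (Ioc 0 T) := by
  simp only [integral_convolution_eq_scaled]
  refine continuousOn_id.smul fun t₀ ht₀ => ?_
  refine intervalIntegral.continuousWithinAt_of_dominated_interval
    (bound := fun σ => M * wnorm ν T g * (t₀ ^ (a - ν) + 1) * ((1 - σ) ^ a * σ ^ (-ν)))
    ?_ ?_ ?_ ?_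
  · filter_upwards [self_mem_nhdsWithin] with t ht
    exact hR.aestronglyMeasurable hg ht
  · have hc : Tendsto (fun t : ℝ => t ^ (a - ν)) (𝓝[Ioc 0 T] t₀) (𝓝 (t₀ ^ (a - ν))) :=
      (Real.continuousAt_rpow_const _ _ (Or.inl ht₀.1.ne')).continuousWithinAt
    filter_upwards [self_mem_nhdsWithin, hc.eventually (gt_mem_nhds (lt_add_one _))] with t ht hlt
    refine ae_mem_uIoc_imp fun σ hσ => (hR.norm_le hM hg ht hσ).trans ?_
    have h1 := Real.rpow_nonneg hσ.1.le (-ν)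
    have h2 := Real.rpow_nonneg (one_sub_mem_Ioo hσ).1.le a
    have h3 := wnorm_nonneg (θ := ν) (T := T) (u := g)
    gcongr
  · exact (intervalIntegrable_one_sub_rpow_mul_rpow ha (by linarith)).const_mul _
  · refine ae_mem_uIoc_imp fun σ hσ => ?_
    refine hR.continuousOn_comp (by fun_prop)
      (fun t ht => mul_mem_Ioc ht (one_sub_mem_Ioo hσ)) ?_ t₀ ht₀
    exact hg.1.comp (by fun_prop) fun t ht => mul_mem_Ioc ht hσ

theorem IsSingularFamily.memC_integral (hR : IsSingularFamily a M T R) (hM : 0 ≤ M)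
    (hT : 0 < T) (ha : -1 < a) (hν : ν < 1) (hg : memC ν T g) {κ : ℝ} (hκ : 0 < κ + (1 + a - ν)) :
    memC κ T (fun t => ∫ s in (0 : ℝ)..t, R (t - s) (g s)) := by
  refine ⟨hR.continuousOn_integral hM ha hν hg, ?_⟩
  set C := M * (∫ σ in (0 : ℝ)..1, (1 - σ) ^ a * σ ^ (-ν)) * wnorm ν T g with hC
  have h0 : Tendsto (fun t : ℝ => C * t ^ (κ + (1 + a - ν))) (𝓝[>] 0) (𝓝 0) := by
    have h1 : Tendsto (fun t : ℝ => t ^ (κ + (1 + a - ν))) (𝓝[>] 0) (𝓝 0) := by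
      simpa [Real.zero_rpow hκ.ne'] using
        ((Real.continuousAt_rpow_const 0 _ (Or.inr hκ.le)).tendsto).mono_left
          (nhdsWithin_le_nhds (s := Ioi 0))
    simpa using h1.const_mul C
  refine squeeze_zero' ?_ ?_ h0
  · filter_upwards [self_mem_nhdsWithin] with t ht
    exact mul_nonneg (Real.rpow_nonneg (le_of_lt ht) _) (norm_nonneg _)
  · filter_upwards [Ioc_mem_nhdsGT hT] with t ht
    refine (mul_le_mul_of_nonneg_left (hR.norm_integral_le hM ha hν hg ht)
      (Real.rpow_nonneg ht.1.le κ)).trans_eq ?_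
    rw [Real.rpow_add ht.1 κ, hC]
    ring

end Convolution

theorem exists_mem_Ioo_mul_rpow_le {C ℓ ε : ℝ} (hℓ : 0 < ℓ) (hε : 0 < ε) :
    ∃ L ∈ Ioo (0 : ℝ) (1 / 2), C * (2 * L) ^ ℓ ≤ ε := by
  have h1 : Tendsto (fun L : ℝ => C * (2 * L) ^ ℓ) (𝓝[>] 0) (𝓝 0) := by
    have h2 : ContinuousAt (fun L : ℝ => C * (2 * L) ^ ℓ) 0 :=
      ((continuousAt_const.mul continuousAt_id).rpow_const (Or.inr hℓ.le)).const_mul C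
    simpa [Real.zero_rpow hℓ.ne'] using h2.tendsto.mono_left (nhdsWithin_le_nhds (s := Ioi 0))
  obtain ⟨L, hL, hL'⟩ := ((h1.eventually (gt_mem_nhds hε)).and
    (Ioo_mem_nhdsGT (show (0 : ℝ) < 1 / 2 by norm_num))).exists
  exact ⟨L, hL', hL.le⟩

/-- Theorem 2.1 in abstract fixed-point form.  `E_θ` and `E_γ` are Banach spaces
continuously embedded (via `ιθ`, `ιγ`) in the Banach space `E₀`, with `E_θ` dense;
`S(t)` plays the role of the analytic semigroup `e^{tA}`, with `E_θ`-valued lift `Sθ(t)`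
on `(0,T]`; `f` and `Sig = Σ_T` satisfy the superlinear Lipschitz conditions (A2)/(A3).
Then for some `L ∈ (0,1)` and `m > 0`: whenever `‖Σ_T(0)‖ ≤ m`, there is exactly one
function `u ∈ C([0,T],E₀) ∩ C_θ((0,T],E_θ)` (encoded as a pair `(u, uθ)` with
`ιθ ∘ uθ = u` on `(0,T]`, both pinned to `0` outside their domains) with
`‖u‖_{C_θ} + sup_{[0,T]}‖u‖_{E₀} ≤ L` solving the mild equation
`u(t) = S(t)Σ_T(u) + ∫₀ᵗ S(t−s)f(u)(s) ds` on `[0,T]`. -/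
theorem stmt_0
    {E₀ EΘ EΓ : Type*}
    [NormedAddCommGroup E₀] [NormedSpace ℝ E₀] [CompleteSpace E₀]
    [NormedAddCommGroup EΘ] [NormedSpace ℝ EΘ] [CompleteSpace EΘ]
    [NormedAddCommGroup EΓ] [NormedSpace ℝ EΓ] [CompleteSpace EΓ]
    (T θ γ₀ ν ℓ ω cT : ℝ)
    (hT : 0 < T) (hθ : 0 < θ) (hθ1 : θ ≤ 1) (hγ₀ : 0 ≤ γ₀) (hγθ : 0 < 1 + γ₀ - θ)
    (hν0 : 0 ≤ ν) (hν1 : ν < 1) (hℓ : 0 < ℓ) (hω : 1 ≤ ω) (hcT : 0 < cT)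
    (ιθ : EΘ →L[ℝ] E₀) (hιθ : Function.Injective ιθ) (hθdense : DenseRange ιθ)
    (ιγ : EΓ →L[ℝ] E₀) (hιγ : Function.Injective ιγ)
    (S : ℝ → E₀ →L[ℝ] E₀) (Sθ : ℝ → E₀ → EΘ)
    (hS0 : ∀ x : E₀, S 0 x = x)
    (hScont : ∀ x : E₀, ContinuousOn (fun t => S t x) (Icc 0 T))
    (hSbound : ∀ t ∈ Icc (0:ℝ) T, ∀ x : E₀, ‖S t x‖ ≤ ω * ‖x‖)
    (hSθcompat : ∀ t ∈ Ioc (0:ℝ) T, ∀ x : E₀, ιθ (Sθ t x) = S t x)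
    (hSθbound : ∀ t ∈ Ioc (0:ℝ) T, ∀ x : E₀, ‖Sθ t x‖ ≤ ω * t ^ (-θ) * ‖x‖)
    (hSθbound' : ∀ t ∈ Ioc (0:ℝ) T, ∀ y : EΘ, ‖Sθ t (ιθ y)‖ ≤ ω * ‖y‖)
    (hSγbound : ∀ t ∈ Ioc (0:ℝ) T, ∀ z : EΓ, ‖Sθ t (ιγ z)‖ ≤ ω * t ^ (γ₀ - θ) * ‖z‖)
    (hSθcont : ∀ x : E₀, ContinuousOn (fun t => Sθ t x) (Ioc 0 T))
    (f : (ℝ → EΘ) → ℝ → EΓ) (Sig : (ℝ → EΘ) → E₀)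
    (hfmem : ∀ v : ℝ → EΘ, memC θ T v → memC ν T (f v))
    (hf0 : ∀ t ∈ Ioc (0:ℝ) T, f 0 t = 0)
    (hflip : ∀ L ∈ Ioo (0:ℝ) 1, ∀ v w : ℝ → EΘ, memC θ T v → memC θ T w →
      wnorm θ T v + wnorm θ T w ≤ L →
      (∀ t ∈ Ioc (0:ℝ) T, ‖ιθ (v t)‖ + ‖ιθ (w t)‖ ≤ L) →
      wnorm ν T (fun t => f v t - f w t) ≤
        cT * L ^ ℓ * wnorm θ T (fun t => v t - w t))
    (hSiglip : ∀ L ∈ Ioo (0:ℝ) 1, ∀ v w : ℝ → EΘ, memC θ T v → memC θ T w →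
      wnorm θ T v + wnorm θ T w ≤ L →
      (∀ t ∈ Ioc (0:ℝ) T, ‖ιθ (v t)‖ + ‖ιθ (w t)‖ ≤ L) →
      ‖Sig v - Sig w‖ ≤ cT * L ^ ℓ * wnorm θ T (fun t => v t - w t)) :
    ∃ L ∈ Ioo (0:ℝ) 1, ∃ m > (0:ℝ), ‖Sig 0‖ ≤ m →
      ∃! p : (ℝ → E₀) × (ℝ → EΘ),
        ContinuousOn p.1 (Icc 0 T) ∧
        (∀ t, t ∉ Icc (0:ℝ) T → p.1 t = 0) ∧
        (∀ t ∈ Ioc (0:ℝ) T, ιθ (p.2 t) = p.1 t) ∧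
        (∀ t, t ∉ Ioc (0:ℝ) T → p.2 t = 0) ∧
        memC θ T p.2 ∧
        (∀ t ∈ Icc (0:ℝ) T, wnorm θ T p.2 + ‖p.1 t‖ ≤ L) ∧
        (∀ t ∈ Icc (0:ℝ) T,
          IntervalIntegrable (fun s => S (t - s) (ιγ (f p.2 s))) volume 0 t ∧
          p.1 t = S t (Sig p.2) + ∫ s in (0:ℝ)..t, S (t - s) (ιγ (f p.2 s))) := by
  have hω0 : 0 ≤ ω := by linarith
  have hsub : ∀ t ∈ Ioc (0:ℝ) T, ∀ x y, Sθ t x - Sθ t y = Sθ t (x - y) := by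
    intro t ht x y
    apply hιθ
    simp only [map_sub, hSθcompat t ht]
  have hRθ : IsSingularFamily (γ₀ - θ) ω T (fun t z => Sθ t (ιγ z)) := by
    refine ⟨fun t ht z w => ?_, fun t ht => ?_, fun z => hSθcont _⟩
    · rw [hsub t ht, ← map_sub]
      exact hSγbound t ht _
    · simpa using (hsub t ht 0 0).symm
  have hR₀ : IsSingularFamily 0 (ω * ‖ιγ‖) T (fun t z => S t (ιγ z)) := by
    refine ⟨fun t ht z w => ?_, fun t ht => by simp,
      fun z => (hScont _).mono Ioc_subset_Icc_self⟩
    rw [← map_sub, ← map_sub, Real.rpow_zero, mul_one, mul_assoc]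
    exact (hSbound t ⟨ht.1.le, ht.2⟩ _).trans
      (mul_le_mul_of_nonneg_left (ιγ.le_opNorm _) hω0)
  have hM₀ : 0 ≤ ω * ‖ιγ‖ := by positivity
  have ha : -1 < γ₀ - θ := by linarith
  have ha₀ : (-1 : ℝ) < 0 := by norm_num
  have hmemS : ∀ x, memC θ T (fun t => Sθ t x) := by
    intro x
    refine memC_of_forall_approx hT fun ε hε => ?_
    obtain ⟨y, hy⟩ := hθdense.exists_dist_lt x (div_pos hε (by linarith : 0 < ω))
    refine ⟨fun t => Sθ t (ιθ y), ⟨hSθcont _, ?_⟩, fun t ht => ?_⟩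
    · have h0 : Tendsto (fun t : ℝ => t ^ θ * (ω * ‖y‖)) (𝓝[>] 0) (𝓝 0) := by
        have h1 := ((Real.continuousAt_rpow_const 0 θ (Or.inr hθ.le)).tendsto).mono_left
          (nhdsWithin_le_nhds (s := Ioi 0))
        simpa [Real.zero_rpow hθ.ne'] using h1.mul_const (ω * ‖y‖)
      refine squeeze_zero' ?_ ?_ h0
      · filter_upwards [self_mem_nhdsWithin] with t ht
        exact mul_nonneg (Real.rpow_nonneg (le_of_lt ht) _) (norm_nonneg _)
      · filter_upwards [Ioc_mem_nhdsGT hT] with t ht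
        exact mul_le_mul_of_nonneg_left (hSθbound' t ht y) (Real.rpow_nonneg ht.1.le _)
    · rw [hsub t ht]
      refine (mul_le_mul_of_nonneg_left (hSθbound t ht _) (Real.rpow_nonneg ht.1.le _)).trans ?_
      have h2 : t ^ θ * t ^ (-θ) = 1 := by rw [← Real.rpow_add ht.1]; simp
      rw [dist_eq_norm, lt_div_iff₀ (by linarith)] at hy
      calc t ^ θ * (ω * t ^ (-θ) * ‖x - ιθ y‖) = ‖x - ιθ y‖ * ω := by
            linear_combination (ω * ‖x - ιθ y‖) * h2
        _ ≤ ε := hy.le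
  have hSθ : ∀ t ∈ Ioc (0:ℝ) T, ∀ x, t ^ θ * ‖Sθ t x‖ ≤ ω * ‖x‖ := by
    intro t ht x
    refine (mul_le_mul_of_nonneg_left (hSθbound t ht x) (Real.rpow_nonneg ht.1.le _)).trans_eq ?_
    have h2 : t ^ θ * t ^ (-θ) = 1 := by rw [← Real.rpow_add ht.1]; simp
    linear_combination (ω * ‖x‖) * h2
  -- the fixed point map, valued in `EΘ`, and the right-hand side of the mild equation in `E₀`
  set Φ : (ℝ → EΘ) → ℝ → EΘ := fun v => (Ioc 0 T).indicator fun t =>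
    Sθ t (Sig v) + ∫ s in (0:ℝ)..t, Sθ (t - s) (ιγ (f v s)) with hΦdef
  set Ψ : (ℝ → EΘ) → ℝ → E₀ := fun v t =>
    S t (Sig v) + ∫ s in (0:ℝ)..t, S (t - s) (ιγ (f v s)) with hΨdef
  have hΦin : ∀ v, EqOn (Φ v) (fun t =>
      Sθ t (Sig v) + ∫ s in (0:ℝ)..t, Sθ (t - s) (ιγ (f v s))) (Ioc 0 T) :=
    fun v => eqOn_indicator
  have hΦout : ∀ v, ∀ t ∉ Ioc (0:ℝ) T, Φ v t = 0 := fun v t ht => indicator_of_notMem ht _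
  have hιΦ : ∀ v, memC θ T v → ∀ t ∈ Ioc (0:ℝ) T, ιθ (Φ v t) = Ψ v t := by
    intro v hv t ht
    have hint := hRθ.intervalIntegrable hω0 ha hν1 (hfmem v hv) ⟨ht.1.le, ht.2⟩
    rw [hΦin v ht, map_add, hSθcompat t ht, ← ιθ.intervalIntegral_comp_comm hint]
    congr 1
    refine intervalIntegral.integral_congr_ae ?_
    filter_upwards [Measure.ae_ne volume t] with s hst hs
    rw [uIoc_of_le ht.1.le] at hs
    exact hSθcompat _ ⟨sub_pos.2 (lt_of_le_of_ne hs.2 hst), by linarith [hs.1, ht.2]⟩ _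
  have hΦC : ∀ v, memC θ T v → memC θ T (Φ v) := fun v hv =>
    ((hmemS _).add (hRθ.memC_integral hω0 hT ha hν1 (hfmem v hv) (by linarith))).congr hT (hΦin v)
  have hΨC : ∀ v, memC θ T v → ContinuousOn (Ψ v) (Icc 0 T) := fun v hv =>
    (hScont _).add ((hR₀.memC_integral hM₀ hT ha₀ hν1 (hfmem v hv)
      (κ := 0) (by linarith)).continuousOn_Icc (by simp))
  set A := ω * (∫ σ in (0 : ℝ)..1, (1 - σ) ^ (γ₀ - θ) * σ ^ (-ν)) *
    T ^ (θ + (1 + (γ₀ - θ) - ν)) with hA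
  set A₀ := ω * ‖ιγ‖ * (∫ σ in (0 : ℝ)..1, (1 - σ) ^ (0 : ℝ) * σ ^ (-ν)) *
    T ^ (0 + (1 + 0 - ν)) with hA₀
  have hA_nonneg : 0 ≤ A := mul_nonneg
    (mul_nonneg hω0 (integral_one_sub_rpow_mul_rpow_nonneg _ _)) (Real.rpow_nonneg hT.le _)
  have hA₀_nonneg : 0 ≤ A₀ := mul_nonneg
    (mul_nonneg hM₀ (integral_one_sub_rpow_mul_rpow_nonneg _ _)) (Real.rpow_nonneg hT.le _)
  have hΦsub : ∀ v w, memC θ T v → memC θ T w → wnorm θ T (fun t => Φ v t - Φ w t) ≤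
      ω * ‖Sig v - Sig w‖ + A * wnorm ν T (fun t => f v t - f w t) := by
    intro v w hv hw
    refine wnorm_le hT fun t ht => ?_
    rw [hΦin v ht, hΦin w ht, add_sub_add_comm, hsub t ht]
    refine (mul_le_mul_of_nonneg_left (norm_add_le _ _) (Real.rpow_nonneg ht.1.le _)).trans ?_
    rw [mul_add]
    exact add_le_add (hSθ t ht _) (hRθ.rpow_mul_norm_integral_sub_le hω0 ha hν1
      (hfmem v hv) (hfmem w hw) (by linarith) ht)
  have hΦnorm : ∀ v, memC θ T v → wnorm θ T (Φ v) ≤ ω * ‖Sig v‖ + A * wnorm ν T (f v) := by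
    intro v hv
    refine wnorm_le hT fun t ht => ?_
    rw [hΦin v ht]
    refine (mul_le_mul_of_nonneg_left (norm_add_le _ _) (Real.rpow_nonneg ht.1.le _)).trans ?_
    rw [mul_add]
    exact add_le_add (hSθ t ht _) (hRθ.rpow_mul_norm_integral_le hω0 ha hν1
      (hfmem v hv) (by linarith) ht)
  have hΨnorm : ∀ v, memC θ T v → ∀ t ∈ Icc (0:ℝ) T,
      ‖Ψ v t‖ ≤ ω * ‖Sig v‖ + A₀ * wnorm ν T (f v) := by
    intro v hv t ht
    refine (norm_add_le _ _).trans (add_le_add (hSbound t ht _) ?_)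
    rcases ht.1.eq_or_lt with rfl | h0
    · simpa using mul_nonneg hA₀_nonneg wnorm_nonneg
    · have h1 := hR₀.rpow_mul_norm_integral_le hM₀ ha₀ hν1 (hfmem v hv) (κ := 0)
        (by linarith) ⟨h0, ht.2⟩
      rwa [Real.rpow_zero t, one_mul] at h1
  set K := 2 * ω + A + A₀ with hK
  have hK0 : 0 < K := by linarith
  obtain ⟨L, hL, hLK⟩ := exists_mem_Ioo_mul_rpow_le (C := K * cT) hℓ
    (show (0:ℝ) < 1 / 4 by norm_num)
  set δ := cT * (2 * L) ^ ℓ with hδ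
  have hδ0 : 0 ≤ δ := mul_nonneg hcT.le (Real.rpow_nonneg (by linarith [hL.1]) _)
  have hKδ : K * δ ≤ 1 / 4 := by rw [hδ, ← mul_assoc]; exact hLK
  have h2L : 2 * L ∈ Ioo (0:ℝ) 1 := ⟨by linarith [hL.1], by linarith [hL.2]⟩
  refine ⟨L, ⟨hL.1, by linarith [hL.2]⟩, L / (2 * K), div_pos hL.1 (by linarith), fun hm => ?_⟩
  have hKm : K * ‖Sig 0‖ ≤ L / 2 := by
    rw [le_div_iff₀ (by linarith)] at hm
    linarith
  set X : Set (ℝ → EΘ) := {v | (∀ t ∉ Ioc (0:ℝ) T, v t = 0) ∧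
    ∀ s ∈ Ioc (0:ℝ) T, ∀ t ∈ Ioc (0:ℝ) T, s ^ θ * ‖v s‖ + ‖ιθ (v t)‖ ≤ L} with hXdef
  have hXclosed : IsClosed X := by
    simp only [hXdef, ofPred_and, ofPred_forall]
    refine IsClosed.inter ?_ ?_
    · refine isClosed_iInter fun t => isClosed_iInter fun _ => ?_
      exact isClosed_eq (continuous_apply t) continuous_const
    · refine isClosed_iInter fun s => isClosed_iInter fun _ => isClosed_iInter fun t =>
        isClosed_iInter fun _ => isClosed_le ?_ continuous_const
      fun_prop
  have h0X : (0 : ℝ → EΘ) ∈ X := ⟨fun _ _ => rfl, fun _ _ _ _ => by simpa using hL.1.le⟩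
  have hXle : ∀ v ∈ X, ∀ t ∈ Ioc (0:ℝ) T, wnorm θ T v + ‖ιθ (v t)‖ ≤ L := by
    intro v hv t ht
    exact le_sub_iff_add_le.1 (wnorm_le hT fun s hs => le_sub_iff_add_le.2 (hv.2 s hs t ht))
  have hTmem : T ∈ Ioc 0 T := ⟨hT, le_rfl⟩
  have hXnorm : ∀ v ∈ X, wnorm θ T v ≤ L := fun v hv =>
    (le_add_of_nonneg_right (norm_nonneg _)).trans (hXle v hv T hTmem)
  have hXpair : ∀ v ∈ X, ∀ w ∈ X, ∀ t ∈ Ioc (0:ℝ) T, ‖ιθ (v t)‖ + ‖ιθ (w t)‖ ≤ 2 * L := by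
    intro v hv w hw t ht
    linarith [hXle v hv t ht, hXle w hw t ht, wnorm_nonneg (θ := θ) (T := T) (u := v),
      wnorm_nonneg (θ := θ) (T := T) (u := w)]
  have hfX : ∀ v ∈ X, ∀ w ∈ X, memC θ T v → memC θ T w →
      wnorm ν T (fun t => f v t - f w t) ≤ δ * wnorm θ T (fun t => v t - w t) :=
    fun v hv w hw hv' hw' => hflip _ h2L v w hv' hw'
      (by linarith [hXnorm v hv, hXnorm w hw]) (hXpair v hv w hw)
  have hSX : ∀ v ∈ X, ∀ w ∈ X, memC θ T v → memC θ T w →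
      ‖Sig v - Sig w‖ ≤ δ * wnorm θ T (fun t => v t - w t) :=
    fun v hv w hw hv' hw' => hSiglip _ h2L v w hv' hw'
      (by linarith [hXnorm v hv, hXnorm w hw]) (hXpair v hv w hw)
  have hcontr : ∀ v ∈ X, ∀ w ∈ X, memC θ T v → memC θ T w →
      wnorm θ T (fun t => Φ v t - Φ w t) ≤ 1 / 4 * wnorm θ T (fun t => v t - w t) := by
    intro v hv w hw hv' hw'
    set d := wnorm θ T (fun t => v t - w t) with hd
    have hd0 : 0 ≤ d := wnorm_nonneg
    calc _ ≤ _ := hΦsub v w hv' hw'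
      _ ≤ ω * (δ * d) + A * (δ * d) := by
        gcongr
        exacts [hSX v hv w hw hv' hw', hfX v hv w hw hv' hw']
      _ = (ω + A) * δ * d := by ring
      _ ≤ K * δ * d := by gcongr; linarith
      _ ≤ 1 / 4 * d := by gcongr
  have hself : ∀ v ∈ X, memC θ T v → ∀ t ∈ Icc (0:ℝ) T, wnorm θ T (Φ v) + ‖Ψ v t‖ ≤ L := by
    intro v hv hv' t ht
    have hvL : δ * wnorm θ T v ≤ δ * L := mul_le_mul_of_nonneg_left (hXnorm v hv) hδ0
    have h1 : wnorm ν T (f v) ≤ δ * L := by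
      have h2 := hfX v hv 0 h0X hv' memC_zero
      rw [wnorm_congr (v := f v) fun t ht => by simp [hf0 t ht] ] at h2
      simp only [Pi.zero_apply, sub_zero] at h2
      exact h2.trans hvL
    have h3 : ‖Sig v‖ ≤ ‖Sig 0‖ + δ * L := by
      have h4 := hSX v hv 0 h0X hv' memC_zero
      simp only [Pi.zero_apply, sub_zero] at h4
      have h5 := norm_add_le (Sig 0) (Sig v - Sig 0)
      rw [add_sub_cancel] at h5
      linarith
    have hm0 := norm_nonneg (Sig 0)
    calc _ ≤ (ω * ‖Sig v‖ + A * wnorm ν T (f v)) + (ω * ‖Sig v‖ + A₀ * wnorm ν T (f v)) :=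
          add_le_add (hΦnorm v hv') (hΨnorm v hv' t ht)
      _ ≤ (ω * (‖Sig 0‖ + δ * L) + A * (δ * L)) + (ω * (‖Sig 0‖ + δ * L) + A₀ * (δ * L)) := by
        gcongr
      _ = 2 * ω * ‖Sig 0‖ + K * δ * L := by rw [hK]; ring
      _ ≤ K * ‖Sig 0‖ + 1 / 4 * L := by
        have := hL.1.le
        gcongr
        linarith
      _ ≤ L := by linarith [hL.1]
  have hΦX : ∀ v ∈ X, memC θ T v → Φ v ∈ X := by
    refine fun v hv hv' => ⟨hΦout v, fun s hs t ht => ?_⟩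
    rw [hιΦ v hv' t ht]
    exact (add_le_add_left ((hΦC v hv').le_wnorm hs) _).trans (hself v hv hv' t ⟨ht.1.le, ht.2⟩)
  obtain ⟨u, huX, huC, hu⟩ := exists_fixedPoint_of_wnorm_contraction hT hXclosed
    (fun v hv => hv.1) hΦX (fun v _ => hΦC v) (by norm_num) (by norm_num) hcontr h0X memC_zero
  refine ⟨((Icc 0 T).indicator (Ψ u), u), ⟨?_, ?_, ?_, huX.1, huC, ?_, ?_⟩, ?_⟩
  · exact (hΨC u huC).congr eqOn_indicator
  · exact fun t ht => indicator_of_notMem ht (Ψ u)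
  · intro t ht
    dsimp only
    rw [indicator_of_mem (Ioc_subset_Icc_self ht), ← hιΦ u huC t ht, hu]
  · intro t ht
    have h1 := hself u huX huC t ht
    rw [hu] at h1
    dsimp only
    rwa [indicator_of_mem ht]
  · exact fun t ht => ⟨hR₀.intervalIntegrable hM₀ ha₀ hν1 (hfmem u huC) ht, indicator_of_mem ht (Ψ u)⟩
  · rintro ⟨q, w⟩ ⟨-, hq0, hqw, hw0, hwC, hwL, hmild⟩
    simp only at hq0 hqw hw0 hwC hwL hmild
    have hwX : w ∈ X := by
      refine ⟨hw0, fun s hs t ht => ?_⟩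
      rw [hqw t ht]
      exact (add_le_add_left (hwC.le_wnorm hs) _).trans (hwL t (Ioc_subset_Icc_self ht))
    have hw : Φ w = w := by
      funext t
      by_cases ht : t ∈ Ioc 0 T
      · apply hιθ
        rw [hιΦ w hwC t ht, hqw t ht, (hmild t (Ioc_subset_Icc_self ht)).2]
      · rw [hΦout w t ht, hw0 t ht]
    have hwu : w = u := by
      have h1 := hcontr w hwX u huX hwC huC
      rw [hw, hu] at h1
      have h2 := hwC.eqOn_of_wnorm_sub_le_zero huC (by linarith)
      funext t
      by_cases ht : t ∈ Ioc 0 T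
      · exact h2 ht
      · rw [hw0 t ht, huX.1 t ht]
    subst hwu
    congr 1
    funext t
    by_cases ht : t ∈ Icc 0 T
    · rw [indicator_of_mem ht, (hmild t ht).2]
    · rw [indicator_of_notMem ht, hq0 t ht]
end

section
/- Let T > 0, γ ∈ (0,1], ν ∈ [0,1), ω > 0, a ∈ ℝ, and let b : [0,T] → ℝ be continuous with ‖b‖_∞ := sup_{[0,T]}|b|. Let F and G be real Banach spaces and let S : (0,T] → L(F,G) be such that ‖S(t)z‖_G ≤ ω t^{γ−1}‖z‖_F for all t ∈ (0,T] and z ∈ F, and t ↦ S(t)z is continuous from (0,T] to G for every z ∈ F. Let g : (0,T] → F be continuous with N := sup_{s∈(0,T]} s^ν‖g(s)‖_F < ∞. Then for every t ∈ (0,T] the function s ↦ S(t−s)g(s) is Bochner integrable on (0,t), the function t ↦ b(t)·∫₀ᵗ S(t−s)g(s) ds is Bochner integrable on (0,T), and ‖a·∫₀ᵀ S(T−s)g(s) ds + ∫₀ᵀ b(t)(∫₀ᵗ S(t−s)g(s) ds) dt‖_G ≤ ω T^{γ−ν}(|a| + ‖b‖_∞ T/(1+γ−ν))·B(γ, 1−ν)·N.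 -/
open MeasureTheory

/-- The Euler Beta function `B(x,y) = Γ(x)Γ(y)/Γ(x+y)`. -/
noncomputable def betaFn (x y : ℝ) : ℝ := Real.Gamma x * Real.Gamma y / Real.Gamma (x + y)

theorem betaFn_pos {x y : ℝ} (hx : 0 < x) (hy : 0 < y) : 0 < betaFn x y :=
  div_pos (mul_pos (Real.Gamma_pos_of_pos hx) (Real.Gamma_pos_of_pos hy))
    (Real.Gamma_pos_of_pos (add_pos hx hy))

theorem ofReal_betaFn {x y : ℝ} (hx : 0 < x) (hy : 0 < y) :
    (betaFn x y : ℂ) = Complex.betaIntegral x y := by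
  rw [Complex.betaIntegral_eq_Gamma_mul_div _ _ (by simpa) (by simpa), betaFn,
    ← Complex.ofReal_add]
  simp only [Complex.Gamma_ofReal]
  norm_cast

theorem setIntegral_sub_rpow_mul_rpow {x y t : ℝ} (hx : 0 < x) (hy : 0 < y) (ht : 0 < t) :
    ∫ s in Set.Ioo 0 t, (t - s) ^ (x - 1) * s ^ (y - 1) = t ^ (x + y - 1) * betaFn x y := by
  have h := Complex.betaIntegral_scaled y x ht
  rw [intervalIntegral.integral_of_le ht.le, integral_Ioc_eq_integral_Ioo,
    Complex.betaIntegral_symm, ← ofReal_betaFn hx hy] at h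
  have hcongr : ∫ s in Set.Ioo 0 t, (s : ℂ) ^ ((y : ℂ) - 1) * ((t : ℂ) - s) ^ ((x : ℂ) - 1) =
      ∫ s in Set.Ioo 0 t, (((t - s) ^ (x - 1) * s ^ (y - 1) : ℝ) : ℂ) := by
    refine setIntegral_congr_fun measurableSet_Ioo fun s hs => ?_
    push_cast [Complex.ofReal_cpow hs.1.le, Complex.ofReal_cpow (sub_pos.2 hs.2).le]
    ring
  rw [hcongr, integral_complex_ofReal] at h
  have hpow : (t : ℂ) ^ ((y : ℂ) + x - 1) = ((t ^ (x + y - 1) : ℝ) : ℂ) := by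
    push_cast [Complex.ofReal_cpow ht.le]
    rw [add_comm (x : ℂ)]
  rw [hpow] at h
  exact_mod_cast h

theorem integrableOn_sub_rpow_mul_rpow {x y t : ℝ} (hx : 0 < x) (hy : 0 < y) (ht : 0 < t) :
    IntegrableOn (fun s => (t - s) ^ (x - 1) * s ^ (y - 1)) (Set.Ioo 0 t) := by
  by_contra h
  have h0 := integral_undef h
  rw [setIntegral_sub_rpow_mul_rpow hx hy ht] at h0
  exact (mul_pos (Real.rpow_pos_of_pos ht _) (betaFn_pos hx hy)).ne' h0

theorem ContinuousOn.clm_apply_of_norm_le {X Y F G : Type*} [TopologicalSpace X]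
    [TopologicalSpace Y] [NormedAddCommGroup F] [NormedSpace ℝ F] [NormedAddCommGroup G]
    [NormedSpace ℝ G] {D : Set X} {E : Set Y} {S : Y → F →L[ℝ] G} {c : Y → ℝ} {u : X → Y}
    {v : X → F} (hc : ContinuousOn c E) (hSc : ∀ t ∈ E, ∀ z, ‖S t z‖ ≤ c t * ‖z‖)
    (hS : ∀ z, ContinuousOn (fun t => S t z) E) (hu : ContinuousOn u D) (hv : ContinuousOn v D)
    (huD : Set.MapsTo u D E) : ContinuousOn (fun x => S (u x) (v x)) D := by
  intro x₀ hx₀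
  have hdiff : Filter.Tendsto (fun x => S (u x) (v x - v x₀)) (nhdsWithin x₀ D) (nhds 0) := by
    refine squeeze_zero_norm' (a := fun x => c (u x) * ‖v x - v x₀‖) ?_ ?_
    · filter_upwards [self_mem_nhdsWithin] with x hx using hSc _ (huD hx) _
    · have h := ((hc.comp hu huD) x₀ hx₀).tendsto.mul
        ((hv x₀ hx₀).tendsto.sub_const (v x₀)).norm
      simpa using h
  have h := hdiff.add (((hS (v x₀)).comp hu huD) x₀ hx₀).tendsto
  simpa [ContinuousWithinAt] using h

/-- Abstract form of Lemma 4.2: if `‖S(t)z‖_G ≤ ω t^{γ−1}‖z‖_F` and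
`sup_{s} s^ν‖g(s)‖_F ≤ N`, then `s ↦ S(t−s)g(s)` is Bochner integrable on `(0,t)`,
`t ↦ b(t)∫₀ᵗ S(t−s)g(s) ds` is Bochner integrable on `(0,T)`, and
`‖a∫₀ᵀ S(T−s)g(s)ds + ∫₀ᵀ b(t)∫₀ᵗ S(t−s)g(s)ds dt‖ ≤
  ω T^{γ−ν}(|a| + ‖b‖_∞ T/(1+γ−ν)) B(γ,1−ν) N`. -/
theorem stmt_5 {F G : Type*} [NormedAddCommGroup F] [NormedSpace ℝ F] [CompleteSpace F]
    [NormedAddCommGroup G] [NormedSpace ℝ G] [CompleteSpace G]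
    (T γ ν ω a : ℝ) (hT : 0 < T) (hγ0 : 0 < γ) (hγ1 : γ ≤ 1) (hν0 : 0 ≤ ν) (hν1 : ν < 1)
    (hω : 0 < ω)
    (b : ℝ → ℝ) (hb : ContinuousOn b (Set.Icc 0 T))
    (S : ℝ → F →L[ℝ] G)
    (hSb : ∀ t ∈ Set.Ioc (0:ℝ) T, ∀ z : F, ‖S t z‖ ≤ ω * t ^ (γ - 1) * ‖z‖)
    (hScont : ∀ z : F, ContinuousOn (fun t => S t z) (Set.Ioc 0 T))
    (g : ℝ → F) (hg : ContinuousOn g (Set.Ioc 0 T))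
    (N : ℝ) (hN : ∀ s ∈ Set.Ioc (0:ℝ) T, s ^ ν * ‖g s‖ ≤ N) :
    (∀ t ∈ Set.Ioc (0:ℝ) T, IntegrableOn (fun s => S (t - s) (g s)) (Set.Ioo 0 t)) ∧
    IntegrableOn (fun t => b t • ∫ s in Set.Ioo (0:ℝ) t, S (t - s) (g s)) (Set.Ioo 0 T) ∧
    ‖a • (∫ s in Set.Ioo (0:ℝ) T, S (T - s) (g s)) +
        ∫ t in Set.Ioo (0:ℝ) T, b t • ∫ s in Set.Ioo (0:ℝ) t, S (t - s) (g s)‖ ≤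
      ω * T ^ (γ - ν) * (|a| + sSup ((fun t => |b t|) '' Set.Icc 0 T) * T / (1 + γ - ν)) *
        betaFn γ (1 - ν) * N := by
  have hν' : 0 < 1 - ν := by linarith
  have hN0 : 0 ≤ N := le_trans (by positivity) (hN T ⟨hT, le_rfl⟩)
  have hbound : ∀ t ∈ Set.Ioc (0:ℝ) T, ∀ s ∈ Set.Ioo 0 t,
      ‖S (t - s) (g s)‖ ≤ ω * N * ((t - s) ^ (γ - 1) * s ^ (1 - ν - 1)) := by
    intro t ht s hs
    have hts : 0 < t - s := sub_pos.2 hs.2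
    have hsν : 0 < s ^ ν := Real.rpow_pos_of_pos hs.1 ν
    have hgs : ‖g s‖ ≤ N * s ^ (1 - ν - 1) := by
      rw [show 1 - ν - 1 = -ν by ring, Real.rpow_neg hs.1.le, ← div_eq_mul_inv,
        le_div_iff₀ hsν, mul_comm]
      exact hN s ⟨hs.1, hs.2.le.trans ht.2⟩
    calc ‖S (t - s) (g s)‖ ≤ ω * (t - s) ^ (γ - 1) * ‖g s‖ :=
          hSb _ ⟨hts, by linarith [ht.2, hs.1]⟩ _
      _ ≤ ω * (t - s) ^ (γ - 1) * (N * s ^ (1 - ν - 1)) := by gcongr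
      _ = _ := by ring
  have hdom : ∀ t ∈ Set.Ioc (0:ℝ) T, IntegrableOn
      (fun s => ω * N * ((t - s) ^ (γ - 1) * s ^ (1 - ν - 1))) (Set.Ioo 0 t) := fun t ht =>
    (integrableOn_sub_rpow_mul_rpow hγ0 hν' ht.1).const_mul _
  have hc : ContinuousOn (fun t : ℝ => ω * t ^ (γ - 1)) (Set.Ioc 0 T) :=
    continuousOn_const.mul
      (continuousOn_id.rpow_const fun t ht => Or.inl (ne_of_gt ht.1))
  have hconv : ∀ t ∈ Set.Ioc (0:ℝ) T, ‖∫ s in Set.Ioo 0 t, S (t - s) (g s)‖ ≤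
      ω * N * betaFn γ (1 - ν) * t ^ (γ - ν) := by
    intro t ht
    refine (norm_integral_le_of_norm_le (hdom t ht)
      ((ae_restrict_iff' measurableSet_Ioo).2 (ae_of_all _ (hbound t ht)))).trans_eq ?_
    rw [integral_const_mul, setIntegral_sub_rpow_mul_rpow hγ0 hν' ht.1,
      show γ + (1 - ν) - 1 = γ - ν by ring]
    ring
  have hbdd : BddAbove ((fun t => |b t|) '' Set.Icc 0 T) :=
    (isCompact_Icc.image_of_continuousOn hb.abs).bddAbove
  set M := sSup ((fun t => |b t|) '' Set.Icc 0 T)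
  have hbM : ∀ t ∈ Set.Icc 0 T, |b t| ≤ M := fun t ht =>
    le_csSup hbdd (Set.mem_image_of_mem _ ht)
  have hM0 : 0 ≤ M := (abs_nonneg _).trans (hbM 0 ⟨le_rfl, hT.le⟩)
  have hmeas : AEStronglyMeasurable (fun t => ∫ s in Set.Ioo (0:ℝ) t, S (t - s) (g s))
      (volume.restrict (Set.Ioo 0 T)) := by
    let D : Set (ℝ × ℝ) := {p | 0 < p.2 ∧ p.2 < p.1 ∧ p.1 < T}
    have hD : MeasurableSet D :=
      ((isOpen_lt continuous_const continuous_snd).inter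
        ((isOpen_lt continuous_snd continuous_fst).inter
          (isOpen_lt continuous_fst continuous_const))).measurableSet
    have hcont : ContinuousOn (fun p : ℝ × ℝ => S (p.1 - p.2) (g p.2)) D :=
      ContinuousOn.clm_apply_of_norm_le hc hSb hScont (by fun_prop)
        (hg.comp continuousOn_snd fun p hp => ⟨hp.1, (hp.2.1.trans hp.2.2).le⟩)
        fun p hp => ⟨sub_pos.2 hp.2.1, by linarith [hp.1, hp.2.2]⟩
    have hind : AEStronglyMeasurable (D.indicator fun p : ℝ × ℝ => S (p.1 - p.2) (g p.2))
        ((volume.restrict (Set.Ioo 0 T)).prod volume) :=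
      (aestronglyMeasurable_indicator_iff hD).2 (hcont.aestronglyMeasurable hD)
    refine hind.integral_prod_right'.congr ?_
    refine (ae_restrict_iff' measurableSet_Ioo).2 (ae_of_all _ fun t ht => ?_)
    beta_reduce
    rw [← integral_indicator measurableSet_Ioo]
    congr 1 with s
    by_cases hs : s ∈ Set.Ioo 0 t
    · rw [Set.indicator_of_mem hs, Set.indicator_of_mem (show (t, s) ∈ D from ⟨hs.1, hs.2, ht.2⟩)]
    · rw [Set.indicator_of_notMem hs,
        Set.indicator_of_notMem (show (t, s) ∉ D from fun h => hs ⟨h.1, h.2.1⟩)]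
  have hpow : IntegrableOn (fun t : ℝ => M * (ω * N * betaFn γ (1 - ν)) * t ^ (γ - ν))
      (Set.Ioo 0 T) :=
    (((intervalIntegrable_iff_integrableOn_Ioo_of_le hT.le).1
      (intervalIntegral.intervalIntegrable_rpow' (by linarith))).const_mul _)
  have houter : ∀ᵐ t ∂volume.restrict (Set.Ioo 0 T),
      ‖b t • ∫ s in Set.Ioo (0:ℝ) t, S (t - s) (g s)‖ ≤
        M * (ω * N * betaFn γ (1 - ν)) * t ^ (γ - ν) := by
    refine (ae_restrict_iff' measurableSet_Ioo).2 (ae_of_all _ fun t ht => ?_)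
    rw [norm_smul, Real.norm_eq_abs, mul_assoc]
    exact mul_le_mul (hbM t (Set.Ioo_subset_Icc_self ht)) (hconv t (Set.Ioo_subset_Ioc_self ht))
      (norm_nonneg _) hM0
  refine ⟨fun t ht => ?_, ?_, ?_⟩
  · refine (hdom t ht).mono' (ContinuousOn.aestronglyMeasurable ?_ measurableSet_Ioo)
      ((ae_restrict_iff' measurableSet_Ioo).2 (ae_of_all _ (hbound t ht)))
    exact ContinuousOn.clm_apply_of_norm_le hc hSb hScont (by fun_prop)
      (hg.mono fun s hs => ⟨hs.1, hs.2.le.trans ht.2⟩)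
      fun s hs => ⟨sub_pos.2 hs.2, by linarith [hs.1, ht.2]⟩
  · exact hpow.mono' (((hb.mono Set.Ioo_subset_Icc_self).aestronglyMeasurable
      measurableSet_Ioo).smul hmeas) houter
  · have hint : ∫ t in Set.Ioo (0:ℝ) T, t ^ (γ - ν) = T ^ (γ - ν) * T / (1 + γ - ν) := by
      rw [← integral_Ioc_eq_integral_Ioo, ← intervalIntegral.integral_of_le hT.le,
        integral_rpow (Or.inl (by linarith)), Real.zero_rpow (by linarith), sub_zero,
        Real.rpow_add_one hT.ne', show γ - ν + 1 = 1 + γ - ν by ring]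
    calc _ ≤ |a| * (ω * N * betaFn γ (1 - ν) * T ^ (γ - ν)) +
          M * (ω * N * betaFn γ (1 - ν)) * (T ^ (γ - ν) * T / (1 + γ - ν)) := by
          refine (norm_add_le _ _).trans (add_le_add ?_ ?_)
          · rw [norm_smul, Real.norm_eq_abs]
            exact mul_le_mul_of_nonneg_left (hconv T ⟨hT, le_rfl⟩) (abs_nonneg a)
          · rw [← hint, ← integral_const_mul]
            exact norm_integral_le_of_norm_le hpow houter
      _ = _ := by ring
end
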